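/- 𝒞_2(6,4,2) = 21; that is, the maximum cardinality of a cyclic code C ⊆ G_2(6,2) with minimum subspace distance at least 4 equals 21. -/

import Mathlib

open Module

/-- The cyclic shift `αV = {αv : v ∈ V}` of an `Fq`-subspace `V` of the extension field `F`
by a field element `α`. -/
def cyclicShift (Fq F : Type*) [Field Fq] [Field F] [Algebra Fq F]
    (α : F) (V : Submodule Fq F) : Submodule Fq F :=
  Submodule.map (LinearMap.mulLeft Fq α) V

/-- The subspace distance `d(U,W) = dim U + dim W − 2 dim (U ∩ W)`. -/
noncomputable def subspaceDist (Fq F : Type*) [Field Fq] [Field F] [Algebra Fq F]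
    (U W : Submodule Fq F) : ℕ :=
  finrank Fq U + finrank Fq W - 2 * finrank Fq ↥(U ⊓ W)

/-- `C` is a cyclic code in the Grassmannian `G_q(n,k)` (all members have dimension `k`,
and `C` is closed under cyclic shifts by nonzero field elements) with minimum subspace
distance at least `d`. -/
def IsCyclicCode (Fq F : Type*) [Field Fq] [Field F] [Algebra Fq F]
    (k d : ℕ) (C : Set (Submodule Fq F)) : Prop :=
  (∀ U ∈ C, finrank Fq U = k) ∧
  (∀ α : F, α ≠ 0 → ∀ U ∈ C, cyclicShift Fq F α U ∈ C) ∧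
  (∀ U ∈ C, ∀ W ∈ C, U ≠ W → d ≤ subspaceDist Fq F U W)

/-- The orbit `orb(V) = {αV : α ∈ F, α ≠ 0}` of a subspace `V`. -/
def orbitOf (Fq F : Type*) [Field Fq] [Field F] [Algebra Fq F]
    (V : Submodule Fq F) : Set (Submodule Fq F) :=
  {W | ∃ α : F, α ≠ 0 ∧ W = cyclicShift Fq F α V}

/-- The set of orbits of members of a code `C`. -/
def orbitsOf (Fq F : Type*) [Field Fq] [Field F] [Algebra Fq F]
    (C : Set (Submodule Fq F)) : Set (Set (Submodule Fq F)) :=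
  {O | ∃ V ∈ C, O = orbitOf Fq F V}

/-- Members of a family of `k`-dimensional subspaces meeting pairwise trivially partition the
nonzero vectors that they cover. -/
theorem ncard_mul_eq_ncard_biUnion {K E : Type*} [Field K] [AddCommGroup E] [Module K E]
    [Finite E] {k : ℕ} {C : Set (Submodule K E)} (hk : ∀ U ∈ C, finrank K U = k)
    (hd : ∀ U ∈ C, ∀ W ∈ C, U ≠ W → U ⊓ W = ⊥) :
    C.ncard * (Nat.card K ^ k - 1) = (⋃ U ∈ C, (U : Set E) \ {0}).ncard := by
  classical
  have hC : C.Finite := Set.toFinite C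
  have : Fintype E := Fintype.ofFinite E
  have hunion : (⋃ U ∈ C, (U : Set E) \ {0}) =
      ((hC.toFinset.biUnion fun U => ((U : Set E) \ {0}).toFinset : Finset E) : Set E) := by
    ext x
    simp
  rw [hunion, Set.ncard_coe_finset, Finset.card_biUnion]
  · rw [Finset.sum_const_nat (m := Nat.card K ^ k - 1), Set.ncard_eq_toFinset_card C hC]
    intro U hU
    rw [← Set.ncard_eq_toFinset_card', Set.ncard_sdiff_singleton_of_mem U.zero_mem,
      ← hk U (hC.mem_toFinset.1 hU), ← Module.natCard_eq_pow_finrank]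
    rfl
  · intro U hU W hW hne
    rw [Function.onFun, Finset.disjoint_left]
    intro x hx hy
    simp only [Set.mem_toFinset, Set.mem_sdiff, SetLike.mem_coe, Set.mem_singleton_iff] at hx hy
    have hmem : x ∈ U ⊓ W := ⟨hx.1, hy.1⟩
    rw [hd U (hC.mem_toFinset.1 hU) W (hC.mem_toFinset.1 hW) hne] at hmem
    exact hx.2 ((Submodule.mem_bot K).1 hmem)

section CyclicShift

variable {Fq F : Type*} [Field Fq] [Field F] [Algebra Fq F]

theorem mem_cyclicShift {α x : F} {V : Submodule Fq F} :
    x ∈ cyclicShift Fq F α V ↔ ∃ v ∈ V, α * v = x := by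
  simp [cyclicShift]

theorem finrank_cyclicShift {α : F} (hα : α ≠ 0) (V : Submodule Fq F) :
    finrank Fq (cyclicShift Fq F α V) = finrank Fq V :=
  (V.equivMapOfInjective (LinearMap.mulLeft Fq α) (mul_right_injective₀ hα)).finrank_eq.symm

theorem cyclicShift_cyclicShift (α β : F) (V : Submodule Fq F) :
    cyclicShift Fq F α (cyclicShift Fq F β V) = cyclicShift Fq F (α * β) V := by
  rw [cyclicShift, cyclicShift, cyclicShift, ← Submodule.map_comp, LinearMap.mulLeft_mul]

/-- A shift of a subfield is the shift by any of its nonzero elements. -/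
theorem cyclicShift_eq_of_mem {K : IntermediateField Fq F} {α x : F} (hx : x ≠ 0)
    (h : x ∈ cyclicShift Fq F α K.toSubmodule) :
    cyclicShift Fq F α K.toSubmodule = cyclicShift Fq F x K.toSubmodule := by
  obtain ⟨v, hv, rfl⟩ := mem_cyclicShift.1 h
  have hv0 : v ≠ 0 := right_ne_zero_of_mul hx
  ext y
  simp only [mem_cyclicShift]
  constructor
  · rintro ⟨w, hw, rfl⟩
    exact ⟨v⁻¹ * w, K.mul_mem (K.inv_mem hv) hw, by field_simp⟩
  · rintro ⟨w, hw, rfl⟩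
    exact ⟨v * w, K.mul_mem hv hw, by ring⟩

/-- Distinct shifts of a subfield meet trivially. -/
theorem cyclicShift_inf_eq_bot {K : IntermediateField Fq F} {α β : F}
    (h : cyclicShift Fq F α K.toSubmodule ≠ cyclicShift Fq F β K.toSubmodule) :
    cyclicShift Fq F α K.toSubmodule ⊓ cyclicShift Fq F β K.toSubmodule = ⊥ := by
  rw [Submodule.eq_bot_iff]
  rintro x ⟨hxα, hxβ⟩
  by_contra hx
  exact h ((cyclicShift_eq_of_mem hx hxα).trans (cyclicShift_eq_of_mem hx hxβ).symm)

theorem inf_eq_bot_of_orbitOf {K : IntermediateField Fq F} :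
    ∀ U ∈ orbitOf Fq F K.toSubmodule, ∀ W ∈ orbitOf Fq F K.toSubmodule, U ≠ W → U ⊓ W = ⊥ := by
  rintro _ ⟨α, -, rfl⟩ _ ⟨β, -, rfl⟩ hne
  exact cyclicShift_inf_eq_bot hne

theorem finrank_of_mem_orbitOf {V U : Submodule Fq F} (hU : U ∈ orbitOf Fq F V) :
    finrank Fq U = finrank Fq V := by
  obtain ⟨α, hα, rfl⟩ := hU
  exact finrank_cyclicShift hα V

/-- The orbit of a subfield of degree `k` is a cyclic code of the largest possible distance. -/
theorem isCyclicCode_orbitOf (K : IntermediateField Fq F) :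
    IsCyclicCode Fq F (finrank Fq K) (2 * finrank Fq K) (orbitOf Fq F K.toSubmodule) := by
  refine ⟨fun U hU => finrank_of_mem_orbitOf hU, ?_, fun U hU W hW hne => ?_⟩
  · rintro α hα _ ⟨β, hβ, rfl⟩
    exact ⟨α * β, mul_ne_zero hα hβ, cyclicShift_cyclicShift α β _⟩
  · rw [subspaceDist, inf_eq_bot_of_orbitOf U hU W hW hne, finrank_of_mem_orbitOf hU,
      finrank_of_mem_orbitOf hW, finrank_bot]
    change 2 * finrank Fq K ≤ finrank Fq K + finrank Fq K - 2 * 0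
    omega

/-- The orbit of a subfield covers all nonzero vectors. -/
theorem biUnion_orbitOf (K : IntermediateField Fq F) :
    (⋃ U ∈ orbitOf Fq F K.toSubmodule, (U : Set F) \ {0}) = {0}ᶜ := by
  ext x
  simp only [Set.mem_iUnion, Set.mem_sdiff, Set.mem_compl_iff, Set.mem_singleton_iff, exists_prop]
  constructor
  · rintro ⟨_, _, _, hx⟩
    exact hx
  · exact fun hx => ⟨_, ⟨x, hx, rfl⟩, mem_cyclicShift.2 ⟨1, K.one_mem, mul_one x⟩, hx⟩

/-- Codewords at the largest possible distance meet trivially. -/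
theorem IsCyclicCode.inf_eq_bot [FiniteDimensional Fq F] {k : ℕ} (hk : 0 < k)
    {C : Set (Submodule Fq F)} (hC : IsCyclicCode Fq F k (2 * k) C) :
    ∀ U ∈ C, ∀ W ∈ C, U ≠ W → U ⊓ W = ⊥ := by
  intro U hU W hW hne
  have h := hC.2.2 U hU W hW hne
  rw [subspaceDist, hC.1 U hU, hC.1 W hW] at h
  exact Submodule.finrank_eq_zero.1 (by omega)

end CyclicShift

/-- 𝒞_2(6,4,2) = 21. -/
theorem C2_greatest :
    IsGreatest {m : ℕ | ∃ C : Set (Submodule (ZMod 2) (GaloisField 2 6)),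
      IsCyclicCode (ZMod 2) (GaloisField 2 6) 2 4 C ∧ C.ncard = m} 21 := by
  have hcompl : ({0}ᶜ : Set (GaloisField 2 6)).ncard = 63 := by
    rw [Set.ncard_compl, GaloisField.card 2 6 (by norm_num), Set.ncard_singleton]
    norm_num
  constructor
  · obtain ⟨f⟩ := FiniteField.nonempty_algHom_of_finrank_dvd (F := ZMod 2)
      (K := GaloisField 2 2) (L := GaloisField 2 6)
      (by rw [GaloisField.finrank 2 (by norm_num), GaloisField.finrank 2 (by norm_num)]; norm_num)
    have hK : finrank (ZMod 2) f.fieldRange = 2 :=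
      (AlgEquiv.ofInjectiveField f).toLinearEquiv.finrank_eq.symm.trans
        (GaloisField.finrank 2 (by norm_num))
    have hcode := isCyclicCode_orbitOf f.fieldRange
    rw [hK] at hcode
    refine ⟨_, hcode, ?_⟩
    have hcount := ncard_mul_eq_ncard_biUnion hcode.1 inf_eq_bot_of_orbitOf
    rw [biUnion_orbitOf, hcompl, Nat.card_zmod] at hcount
    omega
  · rintro _ ⟨C, hC, rfl⟩
    have hcount := ncard_mul_eq_ncard_biUnion hC.1 (hC.inf_eq_bot (k := 2) two_pos)
    have hle : (⋃ U ∈ C, (U : Set (GaloisField 2 6)) \ {0}).ncard ≤ 63 :=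
      hcompl ▸ Set.ncard_le_ncard (Set.iUnion₂_subset fun U _ x hx => hx.2)
    rw [Nat.card_zmod] at hcount
    omega
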